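/- arXiv:2105.03927 — 3 statements merged into one kernel-verified Lean document; each statement's English description precedes it below -/
import Mathlib

section
/- For every positive integer $n$ and every nonzero complex number $a$, $\sum_{k=1}^{n} \frac{(-a)^k}{k} \sum_{j=1}^{k} \frac{(-1/a)^j}{j} = H_n^{(2)} + \sum_{k=1}^{n} \frac{(H_k + H_{n-k} - H_n)(-a)^k}{k}$. -/
/-- The `n`-th harmonic number `H_n = ∑_{k=1}^n 1/k`, with `H_0 = 0`. -/
noncomputable def H (n : ℕ) : ℝ := ∑ i ∈ Finset.range n, (1 : ℝ) / (i + 1)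

/-- The generalized harmonic number of order 2, `H_n^{(2)} = ∑_{k=1}^n 1/k^2`. -/
noncomputable def H2 (n : ℕ) : ℝ := ∑ i ∈ Finset.range n, (1 : ℝ) / (i + 1) ^ 2


lemma H_succ_aux (n : ℕ) : H (n + 1) = H n + 1 / ((n : ℝ) + 1) := by
  simp [H, Finset.sum_range_succ]

lemma main_aux (n : ℕ) (a : ℂ) (ha : a ≠ 0) :
    ∑ k ∈ Finset.Icc 1 n, (-a) ^ k / (k : ℂ) *
        ∑ j ∈ Finset.Icc 1 k, (-1 / a) ^ j / (j : ℂ) =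
      ((H2 n : ℝ) : ℂ) +
        ∑ k ∈ Finset.Icc 1 n, ((H k + H (n - k) - H n : ℝ) : ℂ) * (-a) ^ k / (k : ℂ) := by
  have hpow : ∀ j : ℕ, (-a) ^ j * (-1 / a) ^ j = 1 := by
    intro j
    rw [← mul_pow]
    have : -a * (-1 / a) = 1 := by field_simp
    rw [this, one_pow]
  induction n with
  | zero => simp [H2]
  | succ n ih =>
    rw [Finset.sum_Icc_succ_top (by omega), ih, Finset.sum_Icc_succ_top (by omega),
      Finset.sum_Icc_succ_top (by omega)]
    have hn : ((n : ℂ) + 1) ≠ 0 := Nat.cast_add_one_ne_zero n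
    have h0 : H (n + 1 - (n + 1)) = 0 := by simp [H]
    have h2 : H2 (n + 1) = H2 n + 1 / ((n : ℝ) + 1) ^ 2 := by
      simp [H2, Finset.sum_range_succ]
    have e1 : (-a) ^ (n + 1) / ((n + 1 : ℕ) : ℂ) * ((-1 / a) ^ (n + 1) / ((n + 1 : ℕ) : ℂ))
        = 1 / ((n : ℂ) + 1) ^ 2 := by
      rw [div_mul_div_comm, hpow]
      push_cast
      ring
    have e2 : (-a) ^ (n + 1) / ((n + 1 : ℕ) : ℂ) *
        ∑ j ∈ Finset.Icc 1 n, (-1 / a) ^ j / (j : ℂ) =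
        ∑ k ∈ Finset.Icc 1 n, (-a) ^ k / (((n : ℂ) + 1) * ((n + 1 - k : ℕ) : ℂ)) := by
      rw [Finset.mul_sum]
      refine Finset.sum_nbij' (fun j => n + 1 - j) (fun j => n + 1 - j) ?_ ?_ ?_ ?_ ?_
      · intro j hj; simp only [Finset.mem_Icc] at hj ⊢; omega
      · intro j hj; simp only [Finset.mem_Icc] at hj ⊢; omega
      · intro j hj; simp only [Finset.mem_Icc] at hj ⊢; omega
      · intro j hj; simp only [Finset.mem_Icc] at hj ⊢; omega
      · intro j hj
        simp only [Finset.mem_Icc] at hj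
        have h1 : n + 1 - (n + 1 - j) = j := by omega
        have h3 : (-a) ^ (n + 1) = (-a) ^ (n + 1 - j) * (-a) ^ j := by
          rw [← pow_add]; congr 1; omega
        rw [h1, h3, div_mul_div_comm, mul_assoc, hpow]
        push_cast
        ring
    have e3 : ∑ k ∈ Finset.Icc 1 n,
          ((H k + H (n + 1 - k) - H (n + 1) : ℝ) : ℂ) * (-a) ^ k / (k : ℂ) =
        ∑ k ∈ Finset.Icc 1 n, ((H k + H (n - k) - H n : ℝ) : ℂ) * (-a) ^ k / (k : ℂ) +
        ∑ k ∈ Finset.Icc 1 n, (-a) ^ k / (((n : ℂ) + 1) * ((n + 1 - k : ℕ) : ℂ)) := by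
      rw [← Finset.sum_add_distrib]
      refine Finset.sum_congr rfl ?_
      intro k hk
      simp only [Finset.mem_Icc] at hk
      obtain ⟨m, rfl⟩ := Nat.exists_eq_add_of_le hk.2
      have h1 : k + m + 1 - k = m + 1 := by omega
      have h3 : k + m - k = m := by omega
      have hk0 : (k : ℂ) ≠ 0 := by
        have : k ≠ 0 := by omega
        exact_mod_cast this
      have hm : (m : ℂ) + 1 ≠ 0 := Nat.cast_add_one_ne_zero m
      rw [h1, h3, H_succ_aux, H_succ_aux]
      push_cast at hn ⊢
      field_simp
      ring
    rw [mul_add, e1, e2, e3, h0, h2]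
    push_cast
    ring

/-- For every positive integer `n` and every nonzero complex `a`,
`∑_{k=1}^n ((-a)^k/k) ∑_{j=1}^k ((-1/a)^j/j)
  = H_n^{(2)} + ∑_{k=1}^n (H_k + H_{n-k} - H_n)(-a)^k/k`. -/
theorem sum_neg_pow_div_mul_sum (n : ℕ) (hn : 0 < n) (a : ℂ) (ha : a ≠ 0) :
    ∑ k ∈ Finset.Icc 1 n, (-a) ^ k / (k : ℂ) *
        ∑ j ∈ Finset.Icc 1 k, (-1 / a) ^ j / (j : ℂ) =
      ((H2 n : ℝ) : ℂ) +
        ∑ k ∈ Finset.Icc 1 n, ((H k + H (n - k) - H n : ℝ) : ℂ) * (-a) ^ k / (k : ℂ) := by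
  exact main_aux n a ha
end

section
/- Let $n$ be a positive integer and let $a \ge 2$ be a real number. Then $\int_{0}^{1} \frac{1-x^n}{1-x} \log^2(a-x)\, dx = H_n \log^2(a-1) + 2\zeta(3) - 2 H_n^{(2)} \log(a-1) - 2\log(a-1) \sum_{k=1}^{n} \frac{(H_k + H_{n-k} - H_n) a^k}{k} - \log(a-1)\log^2\Big(\frac{a}{a-1}\Big) - \frac{2}{3}\log^3\Big(\frac{a}{a-1}\Big) - 2\,\mathrm{Li}_3\Big(\frac{a-1}{a}\Big) - 2\log\Big(\frac{a}{a-1}\Big)\mathrm{Li}_2\Big(\frac{a-1}{a}\Big) - \sum_{k=1}^{\infty} \frac{2(-1)^k H_{k-1}}{k^2 (a-1)^k \binom{n+k}{k}} + 2\log(a-1)\log\Big(\frac{a}{a-1}\Big) \sum_{k=1}^{n} \frac{a^k}{k}$. -/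
/-- The dilogarithm function `Li₂(x) = ∑_{k=1}^∞ x^k/k²`. -/
noncomputable def Li2 (x : ℝ) : ℝ := ∑' k : ℕ, x ^ (k + 1) / ((k : ℝ) + 1) ^ 2

/-- The trilogarithm function `Li₃(x) = ∑_{k=1}^∞ x^k/k³`. -/
noncomputable def Li3 (x : ℝ) : ℝ := ∑' k : ℕ, x ^ (k + 1) / ((k : ℝ) + 1) ^ 3

/-- `ζ(3) = ∑_{k=1}^∞ 1/k³`, the value of the Riemann zeta function at 3. -/
noncomputable def zeta3 : ℝ := ∑' k : ℕ, (1 : ℝ) / ((k : ℝ) + 1) ^ 3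


theorem beta_int (n k : ℕ) : ∫ y in (0:ℝ)..1, y ^ k * (1 - y) ^ n =
    1 / (((k:ℝ) + 1) * (Nat.choose (n + (k + 1)) (k + 1) : ℝ)) := by
  induction n generalizing k with
  | zero => simp
  | succ n ih =>
    have h : ∫ y in (0:ℝ)..1, (((k:ℝ)+1) * (y ^ k * (1 - y) ^ (n+1)) - ((n:ℝ)+1) * (y ^ (k+1) * (1 - y) ^ n)) = 0 := by
      rw [intervalIntegral.integral_eq_sub_of_hasDerivAt (f := fun y : ℝ => y ^ (k+1) * (1 - y) ^ (n+1))]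
      · simp
      · intro y _
        have h1 := (hasDerivAt_pow (k+1) y).mul (((hasDerivAt_id y).const_sub 1).pow (n+1))
        refine h1.congr_deriv ?_
        simp
        ring
      · apply Continuous.intervalIntegrable
        fun_prop
    rw [intervalIntegral.integral_sub (by apply Continuous.intervalIntegrable; fun_prop) (by apply Continuous.intervalIntegrable; fun_prop),
      intervalIntegral.integral_const_mul, intervalIntegral.integral_const_mul, ih] at h
    have hc := Nat.choose_succ_right_eq (n + (k + 1 + 1)) (k+1)
    have e : n + (k+1+1) - (k+1) = n + 1 := by omega
    rw [e] at hc
    have hc' : (Nat.choose (n + (k + 1 + 1)) (k+1+1) : ℝ) * (k+1+1) = (Nat.choose (n + (k + 1 + 1)) (k+1) : ℝ) * (n + 1) := by exact_mod_cast hc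
    have e2 : n + 1 + (k+1) = n + (k+1+1) := by omega
    rw [e2]
    have p1 : (0:ℝ) < (Nat.choose (n + (k + 1 + 1)) (k+1+1) : ℝ) := by
      exact_mod_cast Nat.choose_pos (by omega)
    have p2 : (0:ℝ) < (Nat.choose (n + (k + 1 + 1)) (k+1) : ℝ) := by
      exact_mod_cast Nat.choose_pos (by omega)
    push_cast at h
    have h3 : ((k:ℝ)+1) * (∫ y in (0:ℝ)..1, y ^ k * (1 - y) ^ (n+1)) = ((n:ℝ)+1) * (1 / (((k:ℝ)+1+1) * (Nat.choose (n + (k + 1 + 1)) (k+1+1) : ℝ))) := by linarith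
    have h4 : ((n:ℝ)+1) * (1 / (((k:ℝ)+1+1) * (Nat.choose (n + (k + 1 + 1)) (k+1+1) : ℝ))) = 1 / (Nat.choose (n + (k + 1 + 1)) (k+1) : ℝ) := by
      rw [mul_comm ((k:ℝ)+1+1), hc']
      field_simp
    rw [h4] at h3
    rw [eq_div_iff (by positivity)]
    rw [eq_div_iff (by positivity)] at h3
    linarith

theorem H_succ (n : ℕ) : H (n+1) = H n + 1 / ((n:ℝ)+1) := by
  simp [H, Finset.sum_range_succ]

theorem H_nonneg (n : ℕ) : 0 ≤ H n := by
  unfold H; positivity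

theorem H_le (n : ℕ) : H n ≤ n := by
  induction n with
  | zero => simp [H]
  | succ n ih =>
    rw [H_succ]; push_cast
    have : 1 / ((n:ℝ)+1) ≤ 1 := by
      rw [div_le_one (by positivity)]; linarith [(Nat.cast_nonneg n : (0:ℝ) ≤ n)]
    linarith

theorem anti_sum (m : ℕ) : ∑ p ∈ Finset.HasAntidiagonal.antidiagonal m, (1 / ((p.1:ℝ)+1)) * (1 / ((p.2:ℝ)+1)) = 2 * H (m+1) / ((m:ℝ)+2) := by
  have h : ∀ p ∈ Finset.HasAntidiagonal.antidiagonal m, (1 / ((p.1:ℝ)+1)) * (1 / ((p.2:ℝ)+1)) = (1 / ((m:ℝ)+2)) * (1 / ((p.1:ℝ)+1) + 1 / ((p.2:ℝ)+1)) := by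
    intro p hp
    have : (m:ℝ) = p.1 + p.2 := by
      rw [Finset.HasAntidiagonal.mem_antidiagonal] at hp; exact_mod_cast hp.symm
    rw [this]
    field_simp
    ring
  rw [Finset.sum_congr rfl h, ← Finset.mul_sum, Finset.sum_add_distrib]
  rw [Finset.Nat.sum_antidiagonal_eq_sum_range_succ_mk, Finset.Nat.sum_antidiagonal_eq_sum_range_succ_mk]
  have := Finset.sum_range_reflect (fun i : ℕ => 1 / ((i:ℝ)+1)) (m+1)
  simp only [add_tsub_cancel_right] at this
  simp only [Nat.succ_eq_add_one]
  rw [this]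
  unfold H
  ring

theorem log_sq_series (t : ℝ) (h0 : 0 ≤ t) (h1 : t < 1) :
    HasSum (fun k : ℕ => 2 * (-1:ℝ)^(k+1) * H k / ((k:ℝ)+1) * t^(k+1)) (Real.log (1+t) ^ 2) := by
  have hab : |(-t)| < 1 := by rw [abs_neg, abs_of_nonneg h0]; exact h1
  have hs := Real.hasSum_pow_div_log_of_abs_lt_one hab
  have hn : Summable (fun n : ℕ => ‖(-t) ^ (n+1) / ((n:ℝ)+1)‖) := hs.summable.abs
  have hp := tsum_mul_tsum_eq_tsum_sum_antidiagonal_of_summable_norm hn hn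
  have hq := (summable_norm_sum_mul_antidiagonal_of_summable_norm hn hn).of_norm.hasSum
  rw [← hp, hs.tsum_eq] at hq
  have := (hasSum_nat_add_iff' (f := fun k : ℕ => 2 * (-1:ℝ)^(k+1) * H k / ((k:ℝ)+1) * t^(k+1)) (g := Real.log (1+t) ^ 2) 1).1
  apply this
  convert hq using 1
  · funext m
    have h : ∀ p ∈ Finset.HasAntidiagonal.antidiagonal m, (-t) ^ (p.1+1) / ((p.1:ℝ)+1) * ((-t) ^ (p.2+1) / ((p.2:ℝ)+1)) = (-t)^(m+2) * ((1 / ((p.1:ℝ)+1)) * (1 / ((p.2:ℝ)+1))) := by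
      intro p hp
      rw [Finset.HasAntidiagonal.mem_antidiagonal] at hp
      subst hp
      ring
    rw [Finset.sum_congr rfl h, ← Finset.mul_sum, anti_sum, neg_pow t]
    push_cast
    have : (m:ℝ)+1+1 = m+2 := by ring
    rw [this]
    ring
  · simp [H]
    ring

theorem series_int (n : ℕ) (hn : 0 < n) (b : ℝ) (hb : 1 ≤ b) :
    ∫ y in (0:ℝ)..1, (1 - y)^n * (Real.log (1 + y / b) ^ 2 / y) =
    ∑' k : ℕ, 2 * (-1 : ℝ) ^ (k + 1) * H k /
            (((k : ℝ) + 1) ^ 2 * b ^ (k + 1) * (Nat.choose (n + (k + 1)) (k + 1) : ℝ)) := by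
  have hb0 : 0 < b := by linarith
  set F : ℕ → ℝ → ℝ := fun k y => (2 * (-1:ℝ)^(k+1) * H k / (((k:ℝ)+1) * b^(k+1))) * (y^k * (1-y)^n) with hF
  have hI : ∀ k, ∫ y in Set.Ioc (0:ℝ) 1, F k y = 2 * (-1 : ℝ) ^ (k + 1) * H k /
            (((k : ℝ) + 1) ^ 2 * b ^ (k + 1) * (Nat.choose (n + (k + 1)) (k + 1) : ℝ)) := by
    intro k
    rw [← intervalIntegral.integral_of_le zero_le_one]
    simp only [hF]
    rw [intervalIntegral.integral_const_mul, beta_int, div_mul_div_comm]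
    congr 1 <;> ring
  have hN : ∀ k, ∫ y in Set.Ioc (0:ℝ) 1, ‖F k y‖ = 2 * H k /
            (((k : ℝ) + 1) ^ 2 * b ^ (k + 1) * (Nat.choose (n + (k + 1)) (k + 1) : ℝ)) := by
    intro k
    have : ∫ y in Set.Ioc (0:ℝ) 1, ‖F k y‖ = ∫ y in Set.Ioc (0:ℝ) 1, (2 * H k / (((k:ℝ)+1) * b^(k+1))) * (y^k * (1-y)^n) := by
      apply MeasureTheory.setIntegral_congr_fun measurableSet_Ioc
      intro y hy
      have p1 : 0 ≤ y := hy.1.le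
      have p2 : 0 ≤ 1 - y := by linarith [hy.2]
      simp only [hF, norm_mul, norm_div, norm_pow, norm_neg, norm_one, one_pow, Real.norm_eq_abs, abs_of_nonneg p1, abs_of_nonneg p2, abs_of_nonneg (H_nonneg k), abs_of_pos hb0, abs_two, mul_one]
      rw [abs_of_pos (by positivity : (0:ℝ) < k+1)]
    rw [this, ← intervalIntegral.integral_of_le zero_le_one]
    rw [intervalIntegral.integral_const_mul, beta_int, div_mul_div_comm]
    congr 1 <;> ring
  have hS : Summable (fun k => ∫ y in Set.Ioc (0:ℝ) 1, ‖F k y‖) := by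
    simp only [hN]
    have s2 : Summable (fun k : ℕ => 2 * (1 / ((k:ℝ)+1)^2)) := by
      have := (summable_nat_add_iff 1).2 (Real.summable_one_div_nat_pow (p := 2).2 (by norm_num))
      push_cast at this
      exact this.mul_left 2
    refine Summable.of_nonneg_of_le ?_ ?_ s2
    · intro k
      have := H_nonneg k
      positivity
    · intro k
      have p1 : (1:ℝ) ≤ b^(k+1) := one_le_pow₀ hb
      have p2 : ((k:ℝ)+1) ≤ (Nat.choose (n + (k + 1)) (k + 1) : ℝ) := by
        have h1 : (1 + (k+1)).choose (k+1) ≤ (n + (k+1)).choose (k+1) := Nat.choose_le_choose _ (by omega)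
        have h2 : (1 + (k+1)).choose (k+1) = k + 2 := by
          rw [add_comm 1 (k+1), Nat.choose_succ_self_right]
        have h3 : k + 1 ≤ (n + (k+1)).choose (k+1) := by omega
        exact_mod_cast h3
      have p3 : ((k:ℝ)+1)^2 * 1 * ((k:ℝ)+1) ≤ ((k : ℝ) + 1) ^ 2 * b ^ (k + 1) * (Nat.choose (n + (k + 1)) (k + 1) : ℝ) := by
        gcongr
      have p4 : 2 * H k ≤ 2 * ((k:ℝ)+1) := by linarith [H_le k]
      calc _ ≤ 2 * ((k:ℝ)+1) / (((k:ℝ)+1)^2 * 1 * ((k:ℝ)+1)) := by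
            apply div_le_div₀ (by positivity) p4 (by positivity) p3
        _ = _ := by field_simp
  have hFint : ∀ k, MeasureTheory.Integrable (F k) (MeasureTheory.volume.restrict (Set.Ioc (0:ℝ) 1)) := by
    intro k
    have : Continuous (F k) := by simp only [hF]; fun_prop
    exact (this.intervalIntegrable 0 1).1
  have key := MeasureTheory.hasSum_integral_of_summable_integral_norm hFint hS
  simp only [hI] at key
  rw [key.tsum_eq, intervalIntegral.integral_of_le zero_le_one]
  apply MeasureTheory.setIntegral_congr_fun measurableSet_Ioc
  intro y hy
  have hy0 : 0 < y := hy.1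
  simp only
  rcases eq_or_lt_of_le hy.2 with h1 | h1
  · subst h1
    simp [hF, hn.ne']
  · have ht : y / b < 1 := by rw [div_lt_one hb0]; linarith
    have hs := (log_sq_series (y/b) (by positivity) ht).mul_left ((1-y)^n / y)
    have e : (fun k : ℕ => (1-y)^n / y * (2 * (-1:ℝ)^(k+1) * H k / ((k:ℝ)+1) * (y/b)^(k+1))) = fun k => F k y := by
      funext k
      simp only [hF]
      rw [div_pow]
      field_simp
      ring
    rw [e] at hs
    rw [hs.tsum_eq]
    ring

theorem J_int (a : ℝ) (ha : 2 ≤ a) (i : ℕ) :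
    ∫ y in (0:ℝ)..1, (1 - y)^i * Real.log (1 + y / (a-1)) =
    (1 / ((i:ℝ)+1)) * (a^(i+1) * Real.log (a/(a-1)) - ∑ j ∈ Finset.range (i+1), a^(i-j) / ((j:ℝ)+1)) := by
  have hb : 0 < a - 1 := by linarith
  have := intervalIntegral.integral_comp_sub_left (a := 0) (b := 1) (fun x : ℝ => x^i * Real.log (1 + (1-x)/(a-1))) 1
  simp only [sub_sub_cancel, sub_zero, sub_self] at this
  rw [this]
  rw [intervalIntegral.integral_eq_sub_of_hasDerivAt (f := fun x : ℝ => x^(i+1) / ((i:ℝ)+1) * Real.log (1 + (1-x)/(a-1)) + (1 / ((i:ℝ)+1)) * (-a^(i+1) * Real.log (a-x) - ∑ j ∈ Finset.range (i+1), a^(i-j) * (x^(j+1) / ((j:ℝ)+1))))]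
  · rw [Real.log_div (by linarith) hb.ne']
    have e : (1 + (1 - 0) / (a-1)) = a/(a-1) := by field_simp; ring
    simp
    ring
  · intro x hx
    rw [Set.uIcc_of_le zero_le_one] at hx
    have hax : 0 < a - x := by linarith [hx.2]
    have e0 : 1 + (1-x)/(a-1) = (a-x)/(a-1) := by field_simp; ring
    have hpos : 0 < 1 + (1-x)/(a-1) := by rw [e0]; positivity
    have d1 : HasDerivAt (fun x : ℝ => Real.log (1 + (1-x)/(a-1))) ((-1/(a-1)) / (1 + (1-x)/(a-1))) x :=
      ((((hasDerivAt_id x).const_sub 1).div_const (a-1)).const_add 1).log hpos.ne'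
    have d2 : HasDerivAt (fun x : ℝ => Real.log (a-x)) (-1/(a-x)) x :=
      ((hasDerivAt_id x).const_sub a).log hax.ne'
    have d3 : HasDerivAt (fun x : ℝ => ∑ j ∈ Finset.range (i+1), a^(i-j) * (x^(j+1) / ((j:ℝ)+1))) (∑ j ∈ Finset.range (i+1), a^(i-j) * x^j) x := by
      apply HasDerivAt.fun_sum
      intro j _
      refine (((hasDerivAt_pow (j+1) x).div_const ((j:ℝ)+1)).const_mul (a^(i-j))).congr_deriv ?_
      push_cast
      field_simp
    have d4 : HasDerivAt (fun x : ℝ => x^(i+1) / ((i:ℝ)+1)) (x^i) x := by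
      refine ((hasDerivAt_pow (i+1) x).div_const ((i:ℝ)+1)).congr_deriv ?_
      push_cast
      field_simp
    have g : (∑ j ∈ Finset.range (i+1), a^(i-j) * x^j) = (a^(i+1) - x^(i+1)) / (a-x) := by
      rw [eq_div_iff hax.ne']
      have := geom_sum₂_mul x a (i+1)
      simp only [add_tsub_cancel_right] at this
      have e : ∀ j, a^(i-j) * x^j = x^j * a^(i-j) := fun j => mul_comm _ _
      simp only [e]
      linarith
    refine ((d4.mul d1).add (((d2.const_mul (-a^(i+1))).sub d3).const_mul (1/((i:ℝ)+1)))).congr_deriv ?_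
    rw [g, e0]
    field_simp
    ring
  · apply ContinuousOn.intervalIntegrable
    rw [Set.uIcc_of_le zero_le_one]
    apply ContinuousOn.mul (by fun_prop)
    apply ContinuousOn.log (by fun_prop)
    intro x hx
    have : 0 ≤ (1-x)/(a-1) := div_nonneg (by linarith [hx.2]) hb.le
    linarith

theorem G_sum (a M : ℝ) (n : ℕ) :
    ∑ i ∈ Finset.range n, (1 / ((i:ℝ)+1)) * (a^(i+1) * M - ∑ j ∈ Finset.range (i+1), a^(i-j) / ((j:ℝ)+1)) =
    - H2 n - (∑ k ∈ Finset.Icc 1 n, (H k + H (n - k) - H n) * a ^ k / (k : ℝ)) + M * ∑ k ∈ Finset.Icc 1 n, a ^ k / (k : ℝ) := by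
  induction n with
  | zero => simp [H2]
  | succ n ih =>
    rw [Finset.sum_range_succ, ih, Finset.sum_Icc_succ_top (by omega), Finset.sum_Icc_succ_top (by omega)]
    have h2 : H2 (n+1) = H2 n + 1 / ((n:ℝ)+1)^2 := by simp [H2, Finset.sum_range_succ]
    have h0 : H (n+1) + H (n+1-(n+1)) - H (n+1) = 0 := by simp [H]
    rw [h0, h2, Finset.sum_range_succ]
    have hd : ∑ k ∈ Finset.Icc 1 n, (H k + H (n + 1 - k) - H (n+1)) * a ^ k / (k : ℝ) = ∑ k ∈ Finset.Icc 1 n, (H k + H (n - k) - H n) * a ^ k / (k : ℝ) + (1 / ((n:ℝ)+1)) * ∑ k ∈ Finset.Icc 1 n, a^k / ((n - k : ℕ) + 1 : ℝ) := by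
      rw [Finset.mul_sum, ← Finset.sum_add_distrib]
      apply Finset.sum_congr rfl
      intro k hk
      rw [Finset.mem_Icc] at hk
      obtain ⟨m, rfl⟩ := Nat.exists_eq_add_of_le hk.2
      have e1 : k + m + 1 - k = m + 1 := by omega
      have e2 : k + m - k = m := by omega
      rw [e1, e2, H_succ, H_succ]
      have : (0:ℝ) < k := by exact_mod_cast hk.1
      push_cast
      field_simp
      ring
    have hr : ∑ k ∈ Finset.Icc 1 n, a^k / ((n - k : ℕ) + 1 : ℝ) = ∑ j ∈ Finset.range n, a^(n-j) / ((j:ℝ)+1) := by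
      rw [← Finset.sum_range_reflect, Finset.range_eq_Ico, Finset.sum_Ico_eq_sum_range]
      rw [← Finset.Ico_add_one_right_eq_Icc, Finset.sum_Ico_eq_sum_range]
      apply Finset.sum_congr (by simp)
      intro j hj
      have : j < n := by simpa using hj
      have e1 : n - (n - 1 - (0 + j)) = 1 + j := by omega
      have e2 : n - 1 - (0 + j) = n - (1 + j) := by omega
      rw [e1, e2]
    rw [hd, hr]
    simp
    field_simp
    ring

theorem sum2 : Summable (fun k : ℕ => 1 / ((k:ℝ)+1)^2) := by
  have := (summable_nat_add_iff 1).2 (Real.summable_one_div_nat_pow (p := 2).2 (by norm_num))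
  push_cast at this
  exact this

theorem sum3 : Summable (fun k : ℕ => 1 / ((k:ℝ)+1)^3) := by
  have := (summable_nat_add_iff 1).2 (Real.summable_one_div_nat_pow (p := 3).2 (by norm_num))
  push_cast at this
  exact this

theorem Li2_cont : ContinuousOn Li2 (Set.Icc 0 1) := by
  unfold Li2
  refine continuousOn_tsum (fun i => by fun_prop) sum2 ?_
  intro k x hx
  rw [Real.norm_of_nonneg (by have := hx.1; positivity)]
  have := pow_le_one₀ (n := k+1) hx.1 hx.2
  gcongr

theorem Li3_cont : ContinuousOn Li3 (Set.Icc 0 1) := by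
  unfold Li3
  refine continuousOn_tsum (fun i => by fun_prop) sum3 ?_
  intro k x hx
  rw [Real.norm_of_nonneg (by have := hx.1; positivity)]
  have := pow_le_one₀ (n := k+1) hx.1 hx.2
  gcongr

theorem Li3_deriv (u : ℝ) (h0 : 0 < u) (h1 : u < 1) : HasDerivAt Li3 (Li2 u / u) u := by
  have key := hasDerivAt_tsum_of_isPreconnected (u := fun k : ℕ => 1 / ((k:ℝ)+1)^2)
    (g := fun (k:ℕ) (x:ℝ) => x^(k+1) / ((k:ℝ)+1)^3) (g' := fun (k:ℕ) (x:ℝ) => x^k / ((k:ℝ)+1)^2)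
    (t := Set.Ioo 0 1) (y₀ := u) (y := u) sum2 isOpen_Ioo isPreconnected_Ioo ?_ ?_ ⟨h0, h1⟩ ?_ ⟨h0, h1⟩
  · refine HasDerivAt.congr_deriv (f := Li3) key ?_
    unfold Li2
    rw [← tsum_div_const]
    congr 1
    funext k
    field_simp
    ring
  · intro k y hy
    refine ((hasDerivAt_pow (k+1) y).div_const (((k:ℝ)+1)^3)).congr_deriv ?_
    simp
    field_simp
  · intro k y hy
    rw [Real.norm_of_nonneg (by have := hy.1; positivity)]
    have := pow_le_one₀ (n := k) hy.1.le hy.2.le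
    gcongr
  · refine Summable.of_nonneg_of_le (fun k => by positivity) ?_ sum3
    intro k
    have := pow_le_one₀ (n := k+1) h0.le h1.le
    gcongr

theorem Li2_deriv (u : ℝ) (h0 : 0 < u) (h1 : u < 1) : HasDerivAt Li2 (-Real.log (1-u) / u) u := by
  obtain ⟨r, hr1, hr2⟩ := exists_between h1
  have hr0 : 0 < r := h0.trans hr1
  have key := hasDerivAt_tsum_of_isPreconnected (u := fun k : ℕ => r^k)
    (g := fun (k:ℕ) (x:ℝ) => x^(k+1) / ((k:ℝ)+1)^2) (g' := fun (k:ℕ) (x:ℝ) => x^k / ((k:ℝ)+1))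
    (t := Set.Ioo 0 r) (y₀ := u) (y := u) (summable_geometric_of_lt_one hr0.le hr2) isOpen_Ioo isPreconnected_Ioo ?_ ?_ ⟨h0, hr1⟩ ?_ ⟨h0, hr1⟩
  · refine HasDerivAt.congr_deriv (f := Li2) key ?_
    have hs := Real.hasSum_pow_div_log_of_abs_lt_one (x := u) (by rw [abs_of_pos h0]; exact h1)
    rw [← hs.tsum_eq, ← tsum_div_const]
    congr 1
    funext k
    field_simp
    ring
  · intro k y hy
    refine ((hasDerivAt_pow (k+1) y).div_const (((k:ℝ)+1)^2)).congr_deriv ?_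
    simp
    field_simp
  · intro k y hy
    have hy0 := hy.1
    rw [Real.norm_of_nonneg (by positivity)]
    have := pow_le_pow_left₀ hy.1.le hy.2.le k
    calc y^k / ((k:ℝ)+1) ≤ y^k := div_le_self (by positivity) (by linarith [(Nat.cast_nonneg k : (0:ℝ) ≤ k)])
      _ ≤ r^k := this
  · refine Summable.of_nonneg_of_le (fun k => by positivity) ?_ sum2
    intro k
    have := pow_le_one₀ (n := k+1) h0.le h1.le
    gcongr

/-- Antiderivative of `log (1+t)^2 / t`. -/
noncomputable def Afun (t : ℝ) : ℝ :=
  Real.log t * Real.log (1+t)^2 - 2/3 * Real.log (1+t)^3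
    - 2 * Real.log (1+t) * Li2 (1/(1+t)) - 2 * Li3 (1/(1+t))

theorem Afun_deriv (t : ℝ) (ht : 0 < t) : HasDerivAt Afun (Real.log (1+t)^2 / t) t := by
  have p : 0 < 1 + t := by linarith
  have hu0 : 0 < 1/(1+t) := by positivity
  have hu1 : 1/(1+t) < 1 := by rw [div_lt_one p]; linarith
  have d0 := Real.hasDerivAt_log ht.ne'
  have d1 : HasDerivAt (fun t : ℝ => Real.log (1+t)) (1/(1+t)) t :=
    ((hasDerivAt_id t).const_add 1).log p.ne'
  have d2 : HasDerivAt (fun t : ℝ => 1/(1+t)) (-1/(1+t)^2) t := by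
    have h := ((hasDerivAt_id t).const_add 1).fun_inv p.ne'
    simp only [one_div]
    exact h
  have d3 : HasDerivAt (fun t : ℝ => Li2 (1/(1+t))) (-Real.log (1 - 1/(1+t)) / (1/(1+t)) * (-1/(1+t)^2)) t :=
    HasDerivAt.comp (h₂ := Li2) t (Li2_deriv _ hu0 hu1) d2
  have d4 : HasDerivAt (fun t : ℝ => Li3 (1/(1+t))) (Li2 (1/(1+t)) / (1/(1+t)) * (-1/(1+t)^2)) t :=
    HasDerivAt.comp (h₂ := Li3) t (Li3_deriv _ hu0 hu1) d2
  have d := (((d0.mul (d1.pow 2)).sub ((d1.pow 3).const_mul (2/3))).sub ((d1.const_mul 2).mul d3)).sub (d4.const_mul 2)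
  refine HasDerivAt.congr_deriv (f := Afun) d ?_
  have e : 1 - 1/(1+t) = t/(1+t) := by field_simp; ring
  rw [e, Real.log_div ht.ne' p.ne']
  simp
  field_simp
  ring

theorem Afun_cont : ContinuousOn Afun (Set.Ici 0) := by
  have c1 : ContinuousOn (fun t : ℝ => Real.log (1+t)) (Set.Ici 0) := by
    apply ContinuousOn.log (by fun_prop)
    intro x hx
    have : (0:ℝ) ≤ x := hx
    linarith
  have cu : ContinuousOn (fun t : ℝ => 1/(1+t)) (Set.Ici 0) := by
    apply ContinuousOn.div (by fun_prop) (by fun_prop)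
    intro x hx
    have : (0:ℝ) ≤ x := hx
    linarith
  have mu : Set.MapsTo (fun t : ℝ => 1/(1+t)) (Set.Ici 0) (Set.Icc 0 1) := by
    intro x hx
    have : (0:ℝ) ≤ x := hx
    refine ⟨by positivity, ?_⟩
    rw [div_le_one (by positivity)]; linarith
  have c2 : ContinuousOn (fun t : ℝ => Li2 (1/(1+t))) (Set.Ici 0) := Li2_cont.comp cu mu
  have c3 : ContinuousOn (fun t : ℝ => Li3 (1/(1+t))) (Set.Ici 0) := Li3_cont.comp cu mu
  have c0 : ContinuousOn (fun t : ℝ => Real.log t * Real.log (1+t)^2) (Set.Ici 0) := by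
    intro x hx
    rcases eq_or_lt_of_le (show (0:ℝ) ≤ x from hx) with h | h
    · subst h
      unfold ContinuousWithinAt
      simp only [add_zero, Real.log_one, ne_eq, OfNat.ofNat_ne_zero, not_false_eq_true, zero_pow, mul_zero]
      have hc : Continuous (fun t : ℝ => |t * Real.log t| * t) := Real.continuous_mul_log.abs.mul continuous_id
      have ht := (hc.tendsto 0).mono_left (nhdsWithin_le_nhds (s := Set.Ici 0))
      simp only [mul_zero] at ht
      refine squeeze_zero_norm' ?_ ht
      filter_upwards [self_mem_nhdsWithin] with t ht
      have ht0 : (0:ℝ) ≤ t := ht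
      have l0 : 0 ≤ Real.log (1+t) := Real.log_nonneg (by linarith)
      have l1 : Real.log (1+t) ≤ t := by
        have := Real.log_le_sub_one_of_pos (show 0 < 1+t by linarith)
        linarith
      rw [Real.norm_eq_abs, abs_mul, abs_mul, abs_of_nonneg ht0, abs_of_nonneg (sq_nonneg (Real.log (1+t)))]
      have : Real.log (1+t)^2 ≤ t^2 := pow_le_pow_left₀ l0 l1 2
      calc |Real.log t| * Real.log (1+t)^2 ≤ |Real.log t| * t^2 := by gcongr
        _ = _ := by ring
    · have := (Real.continuousAt_log h.ne').continuousWithinAt (s := Set.Ici 0)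
      exact this.mul ((c1 x hx).pow 2)
  unfold Afun
  exact ((c0.sub ((c1.pow 3).const_mul _)).sub ((c1.const_mul 2).mul c2)).sub (c3.const_mul 2)

theorem Aux_deriv (b : ℝ) (hb : 1 ≤ b) (y : ℝ) (hy : 0 < y) :
    HasDerivAt (fun y => Afun (y/b)) (Real.log (1+y/b)^2 / y) y := by
  have hb0 : 0 < b := by linarith
  have := (Afun_deriv (y/b) (by positivity)).comp y ((hasDerivAt_id y).div_const b)
  refine HasDerivAt.congr_deriv this ?_
  field_simp

theorem Aux_cont (b : ℝ) (hb : 1 ≤ b) : ContinuousOn (fun y => Afun (y/b)) (Set.Icc 0 1) := by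
  refine Afun_cont.comp (by fun_prop) ?_
  intro y hy
  exact div_nonneg hy.1 (by linarith)

theorem Aux_intble (b : ℝ) (hb : 1 ≤ b) :
    IntervalIntegrable (fun y => Real.log (1+y/b)^2 / y) MeasureTheory.volume 0 1 := by
  refine intervalIntegral.intervalIntegrable_deriv_of_nonneg (g := fun y => Afun (y/b)) ?_ ?_ ?_
  · rw [Set.uIcc_of_le zero_le_one]; exact Aux_cont b hb
  · intro y hy
    simp only [zero_le_one, min_eq_left, max_eq_right] at hy
    exact Aux_deriv b hb y hy.1
  · intro y hy
    simp only [zero_le_one, min_eq_left, max_eq_right] at hy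
    have := hy.1
    positivity

theorem Aux_int (b : ℝ) (hb : 1 ≤ b) :
    ∫ y in (0:ℝ)..1, Real.log (1+y/b)^2 / y = Afun (1/b) + 2 * zeta3 := by
  rw [intervalIntegral.integral_eq_sub_of_hasDerivAt_of_le zero_le_one (Aux_cont b hb) (fun y hy => Aux_deriv b hb y hy.1) (Aux_intble b hb)]
  simp [Afun, Li3, zeta3]

theorem Q_int (n : ℕ) : ∫ y in (0:ℝ)..1, ∑ i ∈ Finset.range n, (1-y)^i = H n := by
  rw [intervalIntegral.integral_finsetSum (fun i _ => by apply Continuous.intervalIntegrable; fun_prop)]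
  unfold H
  apply Finset.sum_congr rfl
  intro i _
  have := intervalIntegral.integral_comp_sub_left (a := 0) (b := 1) (fun x : ℝ => x^i) 1
  rw [this]
  simp

/-- For `n` a positive integer and real `a ≥ 2`,
`∫₀¹ (1-xⁿ)/(1-x) log²(a-x) dx = H_n log²(a-1) + 2ζ(3) - 2H_n^{(2)} log(a-1)
  - 2 log(a-1) ∑_{k=1}^n (H_k+H_{n-k}-H_n)a^k/k - log(a-1)log²(a/(a-1))
  - (2/3)log³(a/(a-1)) - 2Li₃((a-1)/a) - 2log(a/(a-1))Li₂((a-1)/a)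
  - ∑_{k=1}^∞ 2(-1)^k H_{k-1}/(k²(a-1)^k C(n+k,k))
  + 2 log(a-1) log(a/(a-1)) ∑_{k=1}^n a^k/k`. -/
theorem integral_log_sq_sub (n : ℕ) (hn : 0 < n) (a : ℝ) (ha : 2 ≤ a) :
    ∫ x in (0 : ℝ)..1, (1 - x ^ n) / (1 - x) * Real.log (a - x) ^ 2 =
      H n * Real.log (a - 1) ^ 2 + 2 * zeta3 - 2 * H2 n * Real.log (a - 1) -
        2 * Real.log (a - 1) *
          (∑ k ∈ Finset.Icc 1 n, (H k + H (n - k) - H n) * a ^ k / (k : ℝ)) -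
        Real.log (a - 1) * Real.log (a / (a - 1)) ^ 2 -
        2 / 3 * Real.log (a / (a - 1)) ^ 3 - 2 * Li3 ((a - 1) / a) -
        2 * Real.log (a / (a - 1)) * Li2 ((a - 1) / a) -
        (∑' k : ℕ,
          2 * (-1 : ℝ) ^ (k + 1) * H k /
            (((k : ℝ) + 1) ^ 2 * (a - 1) ^ (k + 1) * (Nat.choose (n + (k + 1)) (k + 1) : ℝ))) +
        2 * Real.log (a - 1) * Real.log (a / (a - 1)) *
          ∑ k ∈ Finset.Icc 1 n, a ^ k / (k : ℝ) := by

  have hb : 1 ≤ a - 1 := by linarith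
  have hb0 : 0 < a - 1 := by linarith
  set b := a - 1 with hbdef
  have hsub := intervalIntegral.integral_comp_sub_left (a := 0) (b := 1) (fun x : ℝ => (1 - x ^ n) / (1 - x) * Real.log (a - x) ^ 2) 1
  simp only [sub_sub_cancel, sub_zero, sub_self] at hsub
  rw [← hsub]
  set Q : ℝ → ℝ := fun y => ∑ i ∈ Finset.range n, (1-y)^i with hQ
  have hQc : Continuous Q := by simp only [hQ]; fun_prop
  have hlc : ContinuousOn (fun y : ℝ => Real.log (1 + y/b)) (Set.uIcc 0 1) := by
    rw [Set.uIcc_of_le zero_le_one]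
    apply ContinuousOn.log (by fun_prop)
    intro y hy
    have := div_nonneg hy.1 hb0.le
    linarith
  have i1 : IntervalIntegrable (fun y => Real.log b ^ 2 * Q y) MeasureTheory.volume 0 1 :=
    (continuous_const.mul hQc).intervalIntegrable _ _
  have i2' : IntervalIntegrable (fun y => Q y * Real.log (1+y/b)) MeasureTheory.volume 0 1 :=
    (hQc.continuousOn.mul hlc).intervalIntegrable
  have i2 := i2'.const_mul (2 * Real.log b)
  have i3 := Aux_intble b hb
  have i4 : IntervalIntegrable (fun y => (1-y)^n * (Real.log (1+y/b)^2 / y)) MeasureTheory.volume 0 1 :=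
    i3.continuousOn_mul (by fun_prop)
  have hdec : ∫ x in (0:ℝ)..1, (1 - (1 - x) ^ n) / x * Real.log (a - (1 - x)) ^ 2 =
      ∫ y in (0:ℝ)..1, (((Real.log b ^ 2 * Q y + 2 * Real.log b * (Q y * Real.log (1+y/b))) + Real.log (1+y/b)^2 / y) - (1-y)^n * (Real.log (1+y/b)^2 / y)) := by
    rw [intervalIntegral.integral_of_le zero_le_one, intervalIntegral.integral_of_le zero_le_one]
    apply MeasureTheory.setIntegral_congr_fun measurableSet_Ioc
    intro y hy
    have hy0 : 0 < y := hy.1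
    have hq : Q y = (1 - (1-y)^n) / y := by
      simp only [hQ]
      rw [geom_sum_eq (by intro h; linarith)]
      have : (1 - y - 1) = -y := by ring
      rw [this, div_neg, ← neg_div]
      ring
    have hl : Real.log (a - (1-y)) = Real.log b + Real.log (1+y/b) := by
      rw [← Real.log_mul hb0.ne' (by positivity)]
      congr 1
      field_simp
      rw [hbdef]; ring
    simp only
    rw [hl, hq]
    ring
  rw [hdec, intervalIntegral.integral_sub ((i1.add i2).add i3) i4, intervalIntegral.integral_add (i1.add i2) i3,
    intervalIntegral.integral_add i1 i2, intervalIntegral.integral_const_mul, intervalIntegral.integral_const_mul,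
    Q_int, Aux_int b hb, series_int n hn b hb]
  have hG : ∫ y in (0:ℝ)..1, Q y * Real.log (1+y/b) = - H2 n - (∑ k ∈ Finset.Icc 1 n, (H k + H (n - k) - H n) * a ^ k / (k : ℝ)) + Real.log (a/b) * ∑ k ∈ Finset.Icc 1 n, a ^ k / (k : ℝ) := by
    rw [← G_sum]
    simp only [hQ, Finset.sum_mul]
    rw [intervalIntegral.integral_finsetSum]
    · exact Finset.sum_congr rfl (fun i _ => J_int a ha i)
    · intro i _
      have hc : Continuous (fun y : ℝ => (1-y)^i) := by fun_prop
      exact (hc.continuousOn.mul hlc).intervalIntegrable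
  rw [hG]
  unfold Afun
  have e1 : 1 + 1/b = a/b := by field_simp; rw [hbdef]; ring
  have e2 : 1/(a/b) = b/a := by rw [one_div_div]
  have e3 : Real.log (1/b) = - Real.log b := by rw [one_div, Real.log_inv]
  rw [e1, e2, e3]
  ring
end

section
/- Let $n$ be a positive integer and let $t$ be a real number with $0 < t \le 1$. Then $\sum_{k=1}^{\infty} \frac{(-t)^k H_{k-1}}{k^2 \binom{n+k}{k}} = \frac{1}{2}\log t \log^2(t+1) - \frac{1}{3}\log^3(1+t) - \log(1+t)\,\mathrm{Li}_2\Big(\frac{1}{1+t}\Big) - \mathrm{Li}_3\Big(\frac{1}{1+t}\Big) + \zeta(3) + \log(1+t) \sum_{k=1}^{n} \frac{H_k}{k}\Big(\frac{t+1}{t}\Big)^k - \frac{1}{2}\log^2(1+t) \sum_{k=1}^{n} \frac{1}{k}\Big(\frac{t+1}{t}\Big)^k - \sum_{p=0}^{n-1} \Big\{ \sum_{k=1}^{n-p} \Big( \frac{H_{p+k} - H_k}{(p+k)k} + \frac{1}{k^2(p+k)} \Big) \Big\} \Big(\frac{t+1}{t}\Big)^p$. -/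
open Filter Topology

namespace AHB

/-- Beta values `B(k+1,n+1)`. -/
noncomputable def b (n k : ℕ) : ℝ := (k.factorial * n.factorial : ℝ) / (n + k + 1).factorial

lemma b_zero (k : ℕ) : b 0 k = 1 / ((k : ℝ) + 1) := by
  unfold b
  have h := Nat.factorial_pos k
  rw [show 0 + k + 1 = k + 1 by ring, Nat.factorial_succ]
  push_cast
  have : (k.factorial : ℝ) ≠ 0 := by positivity
  field_simp
  simp

lemma b_zero_right (n : ℕ) : b n 0 = 1 / ((n : ℝ) + 1) := by
  unfold b
  rw [show n + 0 + 1 = n + 1 by ring, Nat.factorial_succ]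
  push_cast
  have : (n.factorial : ℝ) ≠ 0 := by positivity
  field_simp
  simp

lemma b_succ (n k : ℕ) : b (n + 1) k = b n k - b n (k + 1) := by
  unfold b
  rw [show n + 1 + k + 1 = (n + k + 1) + 1 by ring, show n + (k + 1) + 1 = (n + k + 1) + 1 by ring,
    Nat.factorial_succ (n + k + 1), Nat.factorial_succ n, Nat.factorial_succ k]
  push_cast
  have : ((n + k + 1).factorial : ℝ) ≠ 0 := by positivity
  have : ((n : ℝ) + k + 1 + 1) ≠ 0 := by positivity
  field_simp
  ring

lemma b_shift (n k : ℕ) : b n (k + 1) / ((k : ℝ) + 1) = b (n + 1) k / ((n : ℝ) + 1) := by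
  unfold b
  rw [show n + 1 + k + 1 = (n + k + 1) + 1 by ring, show n + (k + 1) + 1 = (n + k + 1) + 1 by ring,
    Nat.factorial_succ n, Nat.factorial_succ k]
  push_cast
  have : ((n + k + 1 + 1).factorial : ℝ) ≠ 0 := by positivity
  field_simp

lemma b_choose (n k : ℕ) :
    1 / (((k : ℝ) + 1) * (Nat.choose (n + (k + 1)) (k + 1) : ℝ)) = b n k := by
  rw [Nat.cast_choose ℝ (Nat.le_add_left _ _)]
  unfold b
  rw [show n + (k + 1) - (k + 1) = n by omega, show n + k + 1 = n + (k + 1) by ring,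
    Nat.factorial_succ k]
  push_cast
  have : ((n + (k + 1)).factorial : ℝ) ≠ 0 := by positivity
  field_simp

lemma b_nonneg (n k : ℕ) : 0 ≤ b n k := by unfold b; positivity

lemma b_le (n k : ℕ) : b n k ≤ 1 / ((k : ℝ) + 1) := by
  induction n with
  | zero => rw [b_zero]
  | succ n ih => rw [b_succ]; linarith [b_nonneg n (k + 1)]

lemma H_nonneg (k : ℕ) : 0 ≤ H k := by unfold H; positivity

lemma H_succ (k : ℕ) : H (k + 1) = H k + 1 / ((k : ℝ) + 1) := by
  unfold H; rw [Finset.sum_range_succ]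

lemma H_zero : H 0 = 0 := by simp [H]

lemma H_le (k : ℕ) : H k ≤ k := by
  induction k with
  | zero => simp [H]
  | succ n ih =>
    rw [H_succ]; push_cast
    have : 1 / ((n : ℝ) + 1) ≤ 1 := by
      rw [div_le_one (by positivity)]; linarith [Nat.cast_nonneg (α := ℝ) n]
    linarith

lemma b_le_one (n k : ℕ) : b n k ≤ 1 := by
  refine (b_le n k).trans ?_
  rw [div_le_one (by positivity)]; linarith [Nat.cast_nonneg (α := ℝ) k]

lemma summable_lin (z : ℝ) (hz : |z| < 1) : Summable (fun k : ℕ => ((k : ℝ) + 1) * |z| ^ k) := by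
  have h1 := summable_pow_mul_geometric_of_norm_lt_one 1 (r := |z|) (by simpa using hz)
  have h2 := summable_geometric_of_lt_one (abs_nonneg z) hz
  refine (h1.add h2).congr (fun k => ?_)
  simp; ring

lemma summable_of (z : ℝ) (hz : |z| < 1) (a : ℕ → ℝ) (ha : ∀ k, |a k| ≤ (k : ℝ) + 1) :
    Summable (fun k : ℕ => a k * z ^ k) := by
  refine Summable.of_norm_bounded (summable_lin z hz) (fun k => ?_)
  rw [Real.norm_eq_abs, abs_mul, abs_pow]
  exact mul_le_mul_of_nonneg_right (ha k) (by positivity)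

lemma summable_of' (z : ℝ) (hz : |z| < 1) (a : ℕ → ℝ) (ha : ∀ k, |a k| ≤ (k : ℝ) + 1) :
    Summable (fun k : ℕ => z ^ (k + 1) * a k) := by
  refine ((summable_of z hz a ha).mul_left z).congr (fun k => ?_)
  ring

lemma hasDeriv (a : ℕ → ℝ) (ha : ∀ k, |a k| ≤ (k : ℝ) + 1) (z : ℝ) (hz : |z| < 1) :
    HasDerivAt (fun y : ℝ => ∑' k : ℕ, y ^ (k + 1) * (a k / ((k : ℝ) + 1)))
      (∑' k : ℕ, a k * z ^ k) z := by
  obtain ⟨r, hr1, hr2⟩ := exists_between hz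
  have hr0 : 0 < r := (abs_nonneg z).trans_lt hr1
  have hs := summable_lin r (by rwa [abs_of_pos hr0])
  rw [abs_of_pos hr0] at hs
  refine hasDerivAt_tsum_of_isPreconnected (t := Metric.ball (0 : ℝ) r) hs Metric.isOpen_ball
    (convex_ball _ _).isPreconnected (g := fun k y => y ^ (k + 1) * (a k / ((k : ℝ) + 1)))
    (g' := fun k y => a k * y ^ k) (y₀ := 0) ?_ ?_ (by simpa using hr0) ?_ (by simpa using hr1)
  · intro k y _
    have h := (hasDerivAt_pow (k + 1) y).mul_const (a k / ((k : ℝ) + 1))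
    have h2 : ((k + 1 : ℕ) : ℝ) * y ^ (k + 1 - 1) * (a k / ((k : ℝ) + 1)) = a k * y ^ k := by
      rw [Nat.add_sub_cancel]
      push_cast
      have : ((k : ℝ) + 1) ≠ 0 := by positivity
      field_simp
    rw [h2] at h
    exact h
  · intro k y hy
    have hy' : |y| ≤ r := by simpa using (Metric.mem_ball.1 hy).le
    rw [Real.norm_eq_abs, abs_mul, abs_pow]
    gcongr
    exact ha k
  · simp [summable_zero]

/-! Recurrences -/

noncomputable def K (z : ℝ) (n : ℕ) : ℝ := ∑' k : ℕ, z ^ (k + 1) * b n k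
noncomputable def T (z : ℝ) (n : ℕ) : ℝ := ∑' k : ℕ, z ^ (k + 1) * (H k * b n k)
noncomputable def S (z : ℝ) (n : ℕ) : ℝ := ∑' k : ℕ, z ^ (k + 1) * (H k * b n k / ((k : ℝ) + 1))

lemma K_summable (z : ℝ) (hz : |z| < 1) (n : ℕ) : Summable (fun k : ℕ => z ^ (k + 1) * b n k) := by
  refine summable_of' z hz _ (fun k => ?_)
  rw [abs_of_nonneg (b_nonneg n k)]
  linarith [b_le_one n k, Nat.cast_nonneg (α := ℝ) k]

lemma Hb_abs (n k : ℕ) : |H k * b n k| ≤ 1 := by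
  rw [abs_of_nonneg (mul_nonneg (H_nonneg k) (b_nonneg n k))]
  calc H k * b n k ≤ ((k : ℝ) + 1) * (1 / ((k : ℝ) + 1)) :=
        mul_le_mul (by linarith [H_le k]) (b_le n k) (b_nonneg n k) (by positivity)
    _ = 1 := by field_simp

lemma T_summable (z : ℝ) (hz : |z| < 1) (n : ℕ) :
    Summable (fun k : ℕ => z ^ (k + 1) * (H k * b n k)) := by
  refine summable_of' z hz _ (fun k => ?_)
  linarith [Hb_abs n k, Nat.cast_nonneg (α := ℝ) k]

lemma S_summable (z : ℝ) (hz : |z| < 1) (n : ℕ) :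
    Summable (fun k : ℕ => z ^ (k + 1) * (H k * b n k / ((k : ℝ) + 1))) := by
  refine summable_of' z hz _ (fun k => ?_)
  have h0 := Nat.cast_nonneg (α := ℝ) k
  rw [abs_div, abs_of_pos (show (0 : ℝ) < (k : ℝ) + 1 by positivity)]
  rw [div_le_iff₀ (by positivity)]
  nlinarith [Hb_abs n k]

lemma K_succ (z : ℝ) (hz : |z| < 1) (hz0 : z ≠ 0) (n : ℕ) :
    K z (n + 1) = (1 - 1 / z) * K z n + 1 / ((n : ℝ) + 1) := by
  have h1 := K_summable z hz n
  have h2 := (summable_nat_add_iff 1).2 h1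
  have h3 : K z n = z * (1 / ((n : ℝ) + 1)) + ∑' k : ℕ, z ^ (k + 1 + 1) * b n (k + 1) := by
    unfold K
    rw [h1.tsum_eq_zero_add, b_zero_right]; simp
  have h4 : K z (n + 1) = K z n - (1 / z) * ∑' k : ℕ, z ^ (k + 1 + 1) * b n (k + 1) := by
    unfold K
    rw [← tsum_mul_left, ← h1.tsum_sub (h2.mul_left _)]
    refine tsum_congr (fun k => ?_)
    rw [b_succ]
    field_simp
    ring
  rw [h4, eq_sub_of_add_eq' h3.symm]
  field_simp
  ring

lemma T_succ (z : ℝ) (hz : |z| < 1) (hz0 : z ≠ 0) (n : ℕ) :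
    T z (n + 1) = (1 - 1 / z) * T z n + K z (n + 1) / ((n : ℝ) + 1) := by
  have h1 := T_summable z hz n
  have h2 := (summable_nat_add_iff 1).2 h1
  have h3 : T z n = ∑' k : ℕ, z ^ (k + 1 + 1) * (H (k + 1) * b n (k + 1)) := by
    unfold T
    rw [h1.tsum_eq_zero_add, H_zero]; simp
  have h5 := K_summable z hz (n + 1)
  have h4 : T z (n + 1) = T z n - ((1 / z) * (∑' k : ℕ, z ^ (k + 1 + 1) * (H (k + 1) * b n (k + 1)))
       - 1 / ((n : ℝ) + 1) * K z (n + 1)) := by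
    unfold T K
    rw [← tsum_mul_left, ← tsum_mul_left, ← (h2.mul_left _).tsum_sub (h5.mul_left _),
      ← h1.tsum_sub ((h2.mul_left _).sub (h5.mul_left _))]
    refine tsum_congr (fun k => ?_)
    have h6 := b_shift n k
    have h7 : 1 / ((n : ℝ) + 1) * (z ^ (k + 1) * b (n + 1) k)
        = z ^ (k + 1) * (b n (k + 1) / ((k : ℝ) + 1)) := by rw [h6]; ring
    rw [h7, b_succ, H_succ]
    field_simp
    ring
  rw [h4, ← h3]
  ring

lemma S_succ (z : ℝ) (hz : |z| < 1) (n : ℕ) :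
    S z (n + 1) = S z n - T z (n + 1) / ((n : ℝ) + 1) := by
  unfold S T
  rw [div_eq_mul_one_div, mul_comm, ← tsum_mul_left,
    ← (S_summable z hz n).tsum_sub ((T_summable z hz (n + 1)).mul_left _)]
  refine tsum_congr (fun k => ?_)
  have h6 := b_shift n k
  have h7 : 1 / ((n : ℝ) + 1) * (z ^ (k + 1) * (H k * b (n + 1) k))
        = z ^ (k + 1) * H k * (b n (k + 1) / ((k : ℝ) + 1)) := by rw [h6]; ring
  rw [h7, b_succ]
  ring

lemma K_closed (z : ℝ) (hz : |z| < 1) (hz0 : z ≠ 0) (n : ℕ) :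
    K z n = K z 0 * (1 - 1 / z) ^ n
      + ∑ p ∈ Finset.range n, (1 - 1 / z) ^ p / ((n : ℝ) - p) := by
  induction n with
  | zero => simp
  | succ n ih =>
    rw [K_succ z hz hz0, ih, Finset.sum_range_succ']
    push_cast
    rw [mul_add, Finset.mul_sum]
    have : ∀ p ∈ Finset.range n, (1 - 1 / z) * ((1 - 1 / z) ^ p / ((n : ℝ) - p)) =
       (1 - 1 / z) ^ (p + 1) / ((n : ℝ) + 1 - (p + 1)) := by
      intro p _
      rw [show (n : ℝ) + 1 - (p + 1) = n - p by ring]; ring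
    rw [Finset.sum_congr rfl this]
    simp
    ring

lemma T_closed (z : ℝ) (hz : |z| < 1) (hz0 : z ≠ 0) (n : ℕ) :
    T z n = T z 0 * (1 - 1 / z) ^ n + K z 0 * H n * (1 - 1 / z) ^ n
      + ∑ p ∈ Finset.range n, ((H n - H (n - p)) / ((n : ℝ) - p) + 1 / ((n : ℝ) - p) ^ 2)
          * (1 - 1 / z) ^ p := by
  induction n with
  | zero => simp [H_zero]
  | succ n ih =>
    rw [T_succ z hz hz0, ih, K_closed z hz hz0 (n + 1), Finset.sum_range_succ',
      Finset.sum_range_succ' (fun p => ((H (n + 1) - H (n + 1 - p)) / (((n + 1 : ℕ) : ℝ) - p)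
        + 1 / (((n + 1 : ℕ) : ℝ) - p) ^ 2) * (1 - 1 / z) ^ p)]
    have : ∀ p ∈ Finset.range n, ((H (n + 1) - H (n + 1 - (p + 1))) /
        (((n + 1 : ℕ) : ℝ) - ((p + 1 : ℕ) : ℝ))
        + 1 / (((n + 1 : ℕ) : ℝ) - ((p + 1 : ℕ) : ℝ)) ^ 2) * (1 - 1 / z) ^ (p + 1) =
       (1 - 1 / z) * (((H n - H (n - p)) / ((n : ℝ) - p) + 1 / ((n : ℝ) - p) ^ 2)
          * (1 - 1 / z) ^ p) + 
          ((1 - 1 / z) ^ (p + 1) / (((n + 1 : ℕ) : ℝ) - ((p + 1 : ℕ) : ℝ))) / ((n : ℝ) + 1) := by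
      intro p _
      rw [show n + 1 - (p + 1) = n - p by omega, H_succ]
      push_cast
      rw [show (n : ℝ) + 1 - (p + 1) = n - p by ring]; ring
    rw [Finset.sum_congr rfl this, Finset.sum_add_distrib, ← Finset.mul_sum, ← Finset.sum_div,
      Nat.sub_zero, sub_self, H_succ]
    generalize (1 - 1 / z) = u
    generalize ∑ p ∈ Finset.range n, ((H n - H (n - p)) / ((n : ℝ) - p)
      + 1 / ((n : ℝ) - p) ^ 2) * u ^ p = A
    generalize ∑ p ∈ Finset.range n, u ^ (p + 1) / (((n + 1 : ℕ) : ℝ) - ((p + 1 : ℕ) : ℝ)) = B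
    push_cast
    simp only [sub_zero, pow_zero, zero_div, zero_add]
    field_simp
    ring

lemma S_closed (z : ℝ) (hz : |z| < 1) (hz0 : z ≠ 0) (n : ℕ) :
    S z n = S z 0 - K z 0 * (∑ k ∈ Finset.Icc 1 n, H k / (k : ℝ) * (1 - 1 / z) ^ k) -
        T z 0 * (∑ k ∈ Finset.Icc 1 n, 1 / (k : ℝ) * (1 - 1 / z) ^ k) -
        ∑ p ∈ Finset.range n,
          (∑ k ∈ Finset.Icc 1 (n - p),
              ((H (p + k) - H k) / (((p : ℝ) + (k : ℝ)) * (k : ℝ)) +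
                1 / ((k : ℝ) ^ 2 * ((p : ℝ) + (k : ℝ))))) * (1 - 1 / z) ^ p := by
  induction n with
  | zero => simp
  | succ n ih =>
    rw [S_succ z hz, ih, T_closed z hz hz0 (n + 1), Finset.sum_Icc_succ_top (by omega),
      Finset.sum_Icc_succ_top (by omega)]
    have : ∀ p ∈ Finset.range (n + 1), (∑ k ∈ Finset.Icc 1 (n + 1 - p),
              ((H (p + k) - H k) / (((p : ℝ) + (k : ℝ)) * (k : ℝ)) +
                1 / ((k : ℝ) ^ 2 * ((p : ℝ) + (k : ℝ))))) * (1 - 1 / z) ^ p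
        = (∑ k ∈ Finset.Icc 1 (n - p),
              ((H (p + k) - H k) / (((p : ℝ) + (k : ℝ)) * (k : ℝ)) +
                1 / ((k : ℝ) ^ 2 * ((p : ℝ) + (k : ℝ))))) * (1 - 1 / z) ^ p
          + (((H (n + 1) - H (n + 1 - p)) / (((n + 1 : ℕ) : ℝ) - p)
            + 1 / (((n + 1 : ℕ) : ℝ) - p) ^ 2) * (1 - 1 / z) ^ p) / ((n : ℝ) + 1) := by
      intro p hp
      have hp' : p ≤ n := by simpa [Nat.lt_succ_iff] using hp
      obtain ⟨m, rfl⟩ := Nat.exists_eq_add_of_le hp'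
      rw [show p + m + 1 - p = m + 1 by omega, show p + m - p = m by omega,
        Finset.sum_Icc_succ_top (by omega), add_mul, show p + (m + 1) = p + m + 1 by ring]
      congr 1
      push_cast
      rw [show (p : ℝ) + m + 1 - p = m + 1 by ring]
      have : (p : ℝ) + (m + 1) ≠ 0 := by positivity
      have : (p : ℝ) + m + 1 ≠ 0 := by positivity
      field_simp
      ring
    rw [Finset.sum_congr rfl this, Finset.sum_add_distrib, Finset.sum_range_succ
      (fun p => (∑ k ∈ Finset.Icc 1 (n - p),
              ((H (p + k) - H k) / (((p : ℝ) + (k : ℝ)) * (k : ℝ)) +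
                1 / ((k : ℝ) ^ 2 * ((p : ℝ) + (k : ℝ))))) * (1 - 1 / z) ^ p), ← Finset.sum_div]
    simp
    ring

lemma K_zero (z : ℝ) (hz : |z| < 1) : K z 0 = -Real.log (1 - z) := by
  rw [← (Real.hasSum_pow_div_log_of_abs_lt_one hz).tsum_eq]
  unfold K
  refine tsum_congr (fun k => ?_)
  rw [b_zero]; ring

lemma H_abs (k : ℕ) : |H k| ≤ (k : ℝ) + 1 := by
  rw [abs_of_nonneg (H_nonneg k)]; linarith [H_le k]

lemma Hdiv_abs (k : ℕ) : |H k / ((k : ℝ) + 1)| ≤ (k : ℝ) + 1 := by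
  rw [abs_of_nonneg (div_nonneg (H_nonneg k) (by positivity)), div_le_iff₀ (by positivity)]
  nlinarith [H_le k, Nat.cast_nonneg (α := ℝ) k]

lemma genH (z : ℝ) (hz : |z| < 1) : ∑' k : ℕ, H k * z ^ k = -Real.log (1 - z) / (1 - z) := by
  have hz1 : 1 - z ≠ 0 := by have := (abs_lt.1 hz).2; linarith
  have h1 := summable_of z hz H H_abs
  have h2 := (summable_nat_add_iff 1).2 h1
  have h3 : ∑' k : ℕ, H k * z ^ k = ∑' k : ℕ, H (k + 1) * z ^ (k + 1) := by
    rw [h1.tsum_eq_zero_add, H_zero]; simp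
  have h4 : ∑' k : ℕ, H (k + 1) * z ^ (k + 1) - z * ∑' k : ℕ, H k * z ^ k
      = -Real.log (1 - z) := by
    rw [← (Real.hasSum_pow_div_log_of_abs_lt_one hz).tsum_eq, ← tsum_mul_left,
      ← h2.tsum_sub (h1.mul_left _)]
    refine tsum_congr (fun k => ?_)
    rw [H_succ]; ring
  rw [← h3] at h4
  rw [eq_div_iff hz1, ← h4]
  ring

lemma T_zero_deriv (z : ℝ) (hz : |z| < 1) :
    HasDerivAt (fun y => T y 0) (-Real.log (1 - z) / (1 - z)) z := by
  have h := hasDeriv H H_abs z hz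
  rw [genH z hz] at h
  convert h using 1
  funext y
  unfold T
  refine tsum_congr (fun k => ?_)
  rw [b_zero]; ring

lemma T_zero (z : ℝ) (hz : |z| < 1) : T z 0 = Real.log (1 - z) ^ 2 / 2 := by
  have hd : ∀ y ∈ Metric.ball (0 : ℝ) 1,
      HasDerivAt (fun y => T y 0 - Real.log (1 - y) ^ 2 / 2) 0 y := by
    intro y hy
    have hy' : |y| < 1 := by simpa using hy
    have hy1 : 1 - y ≠ 0 := by have := (abs_lt.1 hy').2; linarith
    have h1 : HasDerivAt (fun y : ℝ => 1 - y) (-1) y := by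
      simpa using (hasDerivAt_id y).const_sub 1
    have h2 := ((h1.log hy1).pow 2).div_const 2
    have h3 := (T_zero_deriv y hy').sub h2
    have h4 : -Real.log (1 - y) / (1 - y) -
      ((2 : ℕ) : ℝ) * Real.log (1 - y) ^ (2 - 1) * (-1 / (1 - y)) / 2 = 0 := by
      simp; ring
    rw [h4] at h3
    exact h3
  have h := Metric.isOpen_ball.is_const_of_deriv_eq_zero (𝕜 := ℝ)
    (convex_ball (0 : ℝ) 1).isPreconnected
    (fun y hy => (hd y hy).differentiableAt.differentiableWithinAt)
    (fun y hy => (hd y hy).deriv) (x := z) (y := 0) (by simpa using hz) (by simp)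
  have h0 : T 0 0 = 0 := by simp [T]
  simp only [h0] at h
  simp at h
  linarith

lemma S_zero_deriv (z : ℝ) (hz : |z| < 1) (hz0 : z ≠ 0) :
    HasDerivAt (fun y => S y 0) (Real.log (1 - z) ^ 2 / 2 / z) z := by
  have h := hasDeriv (fun k => H k / ((k : ℝ) + 1)) Hdiv_abs z hz
  have h2 : ∑' k : ℕ, H k / ((k : ℝ) + 1) * z ^ k = Real.log (1 - z) ^ 2 / 2 / z := by
    rw [← T_zero z hz, eq_div_iff hz0, mul_comm]
    unfold T
    rw [← tsum_mul_left]
    refine tsum_congr (fun k => ?_)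
    rw [b_zero]; ring
  rw [h2] at h
  convert h using 1
  funext y
  unfold S
  refine tsum_congr (fun k => ?_)
  rw [b_zero]; ring

lemma one_div_abs (k : ℕ) (m : ℕ) : |1 / ((k : ℝ) + 1) ^ m| ≤ (k : ℝ) + 1 := by
  have h1 : (1 : ℝ) ≤ (k : ℝ) + 1 := by linarith [Nat.cast_nonneg (α := ℝ) k]
  rw [abs_of_nonneg (by positivity)]
  refine le_trans ?_ h1
  rw [div_le_one (by positivity)]
  exact one_le_pow₀ h1

lemma Li2_deriv (z : ℝ) (hz : |z| < 1) (hz0 : z ≠ 0) :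
    HasDerivAt Li2 (-Real.log (1 - z) / z) z := by
  have h := hasDeriv (fun k => 1 / ((k : ℝ) + 1) ^ 1) (fun k => one_div_abs k 1) z hz
  have h2 : ∑' k : ℕ, 1 / ((k : ℝ) + 1) ^ 1 * z ^ k = -Real.log (1 - z) / z := by
    rw [← (Real.hasSum_pow_div_log_of_abs_lt_one hz).tsum_eq, eq_div_iff hz0, mul_comm,
      ← tsum_mul_left]
    refine tsum_congr (fun k => ?_)
    ring
  rw [h2] at h
  convert h using 1
  funext y
  unfold Li2
  refine tsum_congr (fun k => ?_)
  field_simp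

lemma Li3_deriv (z : ℝ) (hz : |z| < 1) (hz0 : z ≠ 0) :
    HasDerivAt Li3 (Li2 z / z) z := by
  have h := hasDeriv (fun k => 1 / ((k : ℝ) + 1) ^ 2) (fun k => one_div_abs k 2) z hz
  have h2 : ∑' k : ℕ, 1 / ((k : ℝ) + 1) ^ 2 * z ^ k = Li2 z / z := by
    rw [eq_div_iff hz0, mul_comm, ← tsum_mul_left]
    unfold Li2
    refine tsum_congr (fun k => ?_)
    ring
  rw [h2] at h
  convert h using 1
  funext y
  unfold Li3
  refine tsum_congr (fun k => ?_)
  field_simp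

lemma summable_inv (m : ℕ) (hm : 1 < m) : Summable (fun k : ℕ => 1 / ((k : ℝ) + 1) ^ m) := by
  have := (summable_nat_add_iff 1).2 (Real.summable_one_div_nat_pow.2 hm)
  simpa using this

lemma Li_cont (m : ℕ) (hm : 1 < m) : ContinuousOn
    (fun x : ℝ => ∑' k : ℕ, x ^ (k + 1) / ((k : ℝ) + 1) ^ m) (Set.Icc 0 1) := by
  refine continuousOn_tsum (fun k => by fun_prop) (summable_inv m hm) (fun k x hx => ?_)
  rw [Real.norm_eq_abs, abs_of_nonneg (div_nonneg (pow_nonneg hx.1 _) (by positivity))]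
  gcongr
  exact pow_le_one₀ hx.1 hx.2

lemma Li2_cont : ContinuousOn Li2 (Set.Icc 0 1) := Li_cont 2 (by norm_num)
lemma Li3_cont : ContinuousOn Li3 (Set.Icc 0 1) := Li_cont 3 (by norm_num)

lemma Li3_one : Li3 1 = zeta3 := by simp [Li3, zeta3]

noncomputable def R (t : ℝ) : ℝ :=
  1 / 2 * Real.log t * Real.log (t + 1) ^ 2 - 1 / 3 * Real.log (1 + t) ^ 3 -
        Real.log (1 + t) * Li2 (1 / (1 + t)) - Li3 (1 / (1 + t)) + zeta3

lemma R_deriv (t : ℝ) (ht : 0 < t) : HasDerivAt R (Real.log (1 + t) ^ 2 / 2 / t) t := by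
  have h1t : (1 + t) ≠ 0 := by positivity
  have hv : |1 / (1 + t)| < 1 := by
    rw [abs_of_pos (by positivity), div_lt_one (by positivity)]; linarith
  have hv0 : 1 / (1 + t) ≠ 0 := by positivity
  have a0 : HasDerivAt (fun t : ℝ => 1 + t) 1 t := by
    simpa using (hasDerivAt_id t).const_add 1
  have a1 : HasDerivAt (fun t : ℝ => Real.log (1 + t)) (1 / (1 + t)) t := a0.log h1t
  have a1' : HasDerivAt (fun t : ℝ => Real.log (t + 1)) (1 / (1 + t)) t := by
    simpa only [add_comm] using a1
  have a2 : HasDerivAt (fun t : ℝ => 1 / (1 + t)) (-1 / (1 + t) ^ 2) t := by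
    simpa only [one_div] using a0.fun_inv h1t
  have a3 : HasDerivAt (fun t : ℝ => Li2 (1 / (1 + t))) _ t := 
    HasDerivAt.comp (h₂ := Li2) t (Li2_deriv _ hv hv0) a2
  have a4 : HasDerivAt (fun t : ℝ => Li3 (1 / (1 + t))) _ t := 
    HasDerivAt.comp (h₂ := Li3) t (Li3_deriv _ hv hv0) a2
  have a5 := (((((((Real.hasDerivAt_log ht.ne').const_mul (1 / 2)).mul (a1'.pow 2)).sub
    ((a1.pow 3).const_mul (1 / 3))).sub (a1.mul a3)).sub a4).add_const zeta3)
  have hl : Real.log (1 - 1 / (1 + t)) = Real.log t - Real.log (1 + t) := by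
    rw [← Real.log_div ht.ne' h1t]; congr 1; field_simp; ring
  rw [hl] at a5
  refine HasDerivAt.congr_deriv a5 ?_
  rw [add_comm t 1]
  simp only [Pi.pow_apply]
  rw [add_comm t 1]
  generalize Real.log (1 + t) = L
  generalize Real.log t = M
  generalize Li2 (1 / (1 + t)) = A
  push_cast
  field_simp
  ring

lemma R_tendsto : Tendsto R (𝓝[>] 0) (𝓝 0) := by
  have hv : Tendsto (fun t : ℝ => 1 / (1 + t)) (𝓝[>] 0) (𝓝[Set.Icc 0 1] 1) := by
    rw [tendsto_nhdsWithin_iff]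
    constructor
    · have : ContinuousAt (fun t : ℝ => 1 / (1 + t)) 0 := by
        apply ContinuousAt.div <;> first | fun_prop | norm_num
      have h := this.tendsto.mono_left (nhdsWithin_le_nhds (s := Set.Ioi 0))
      simpa using h
    · filter_upwards [self_mem_nhdsWithin] with t ht
      have ht' : (0 : ℝ) < t := ht
      refine ⟨by positivity, ?_⟩
      rw [div_le_one (by positivity)]; linarith
  have h2 := (Li2_cont 1 (by simp)).tendsto.comp hv
  have h3 := (Li3_cont 1 (by simp)).tendsto.comp hv
  have hL : Tendsto (fun t : ℝ => Real.log (1 + t)) (𝓝[>] 0) (𝓝 0) := by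
    have : ContinuousAt (fun t : ℝ => Real.log (1 + t)) 0 := by
      apply ContinuousAt.log <;> first | fun_prop | norm_num
    have h := this.tendsto.mono_left (nhdsWithin_le_nhds (s := Set.Ioi 0))
    simpa using h
  have hM : Tendsto (fun t : ℝ => Real.log t * Real.log (t + 1) ^ 2) (𝓝[>] 0) (𝓝 0) := by
    have hb : Tendsto (fun t : ℝ => Real.log t * t ^ (2 : ℝ)) (𝓝[>] 0) (𝓝 0) :=
      tendsto_log_mul_rpow_nhdsGT_zero (by norm_num)
    refine squeeze_zero_norm' ?_ (by simpa using hb.abs)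
    filter_upwards [self_mem_nhdsWithin] with t ht
    have ht' : (0 : ℝ) < t := ht
    have hl0 : 0 ≤ Real.log (t + 1) := Real.log_nonneg (by linarith)
    have hl1 : Real.log (t + 1) ≤ t := by
      have := Real.log_le_sub_one_of_pos (show 0 < t + 1 by linarith); linarith
    rw [Real.norm_eq_abs, abs_mul, abs_of_nonneg (pow_nonneg hl0 2)]
    gcongr
  have h := ((((hM.const_mul (1 / 2)).sub ((hL.pow 3).const_mul (1 / 3))).sub
    (hL.mul h2)).sub h3).add_const zeta3
  rw [Li3_one] at h
  have e : (1 / 2 * 0 - 1 / 3 * 0 ^ 3 - 0 * Li2 1 - zeta3 + zeta3 : ℝ) = 0 := by ring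
  rw [e] at h
  refine h.congr (fun t => ?_)
  simp only [R, Function.comp]
  ring

lemma S_zero (t : ℝ) (ht0 : 0 < t) (ht1 : t < 1) : S (-t) 0 = R t := by
  have hd : ∀ y ∈ Set.Ioo (0 : ℝ) 1, HasDerivAt (fun y => S (-y) 0 - R y) 0 y := by
    intro y hy
    have h1 : HasDerivAt (fun y => S (-y) 0) _ y :=
      (S_zero_deriv (-y) (by rw [abs_neg, abs_of_pos hy.1]; exact hy.2)
      (neg_ne_zero.2 hy.1.ne')).comp y (hasDerivAt_neg y)
    refine (h1.sub (R_deriv y hy.1)).congr_deriv ?_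
    rw [sub_neg_eq_add]
    ring
  have hc : ∀ y ∈ Set.Ioo (0 : ℝ) 1, S (-y) 0 - R y = S (-t) 0 - R t := fun y hy =>
    isOpen_Ioo.is_const_of_deriv_eq_zero (𝕜 := ℝ) isPreconnected_Ioo
    (fun y hy => (hd y hy).differentiableAt.differentiableWithinAt)
    (fun y hy => (hd y hy).deriv) hy ⟨ht0, ht1⟩
  have hS : Tendsto (fun y : ℝ => S (-y) 0) (𝓝[>] 0) (𝓝 0) := by
    have h := (hasDeriv (fun k => H k / ((k : ℝ) + 1)) Hdiv_abs 0 (by simp)).continuousAt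
    have h1 : ContinuousAt (fun y => S y 0) 0 := by
      convert h using 1
      funext y
      unfold S
      refine tsum_congr (fun k => ?_)
      rw [b_zero]; ring
    have h2 : ContinuousAt (fun y : ℝ => S (-y) 0) 0 :=
      ContinuousAt.comp (g := fun y => S y 0) (by simpa using h1) continuous_neg.continuousAt
    have h3 := h2.tendsto.mono_left (nhdsWithin_le_nhds (s := Set.Ioi 0))
    simpa [S] using h3
  have h1 := hS.sub R_tendsto
  have h2 : Tendsto (fun y : ℝ => S (-y) 0 - R y) (𝓝[>] 0) (𝓝 (S (-t) 0 - R t)) := by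
    refine tendsto_const_nhds.congr' ?_
    filter_upwards [Ioo_mem_nhdsGT (show (0 : ℝ) < 1 by norm_num)] with y hy
    exact (hc y hy).symm
  have := tendsto_nhds_unique h1 h2
  linarith

noncomputable def RR (n : ℕ) (t : ℝ) : ℝ := R t +
        Real.log (1 + t) * (∑ k ∈ Finset.Icc 1 n, H k / (k : ℝ) * ((t + 1) / t) ^ k) -
        1 / 2 * Real.log (1 + t) ^ 2 *
          (∑ k ∈ Finset.Icc 1 n, 1 / (k : ℝ) * ((t + 1) / t) ^ k) -
        ∑ p ∈ Finset.range n,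
          (∑ k ∈ Finset.Icc 1 (n - p),
              ((H (p + k) - H k) / (((p : ℝ) + (k : ℝ)) * (k : ℝ)) +
                1 / ((k : ℝ) ^ 2 * ((p : ℝ) + (k : ℝ))))) * ((t + 1) / t) ^ p

lemma main_lt (n : ℕ) (t : ℝ) (ht0 : 0 < t) (ht1 : t < 1) : S (-t) n = RR n t := by
  have hz : |-t| < 1 := by rwa [abs_neg, abs_of_pos ht0]
  have hu : 1 - 1 / (-t) = (t + 1) / t := by field_simp; ring
  rw [S_closed (-t) hz (by linarith), S_zero t ht0 ht1, T_zero _ hz, K_zero _ hz, hu,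
    sub_neg_eq_add]
  unfold RR
  ring

lemma S_cont (n : ℕ) (hn : 0 < n) : ContinuousOn (fun t : ℝ => S (-t) n) (Set.Icc 0 1) := by
  refine continuousOn_tsum (fun k => by fun_prop) (summable_inv 2 (by norm_num))
    (fun k x hx => ?_)
  obtain ⟨m, rfl⟩ := Nat.exists_eq_succ_of_ne_zero hn.ne'
  have hb : b (m + 1) k ≤ 1 / ((k : ℝ) + 1) ^ 2 := by
    clear hn
    induction m with
    | zero =>
      rw [b_succ, b_zero, b_zero]
      push_cast
      have e : 1 / ((k : ℝ) + 1) - 1 / ((k : ℝ) + 1 + 1)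
        = 1 / (((k : ℝ) + 1) * ((k : ℝ) + 1 + 1)) := by field_simp; ring
      rw [e, sq]
      gcongr
      linarith
    | succ m ih => rw [b_succ]; linarith [b_nonneg (m + 1) (k + 1)]
  have hH : H k / ((k : ℝ) + 1) ≤ 1 := by
    rw [div_le_one (by positivity)]; linarith [H_le k]
  have h0 : 0 ≤ H k / ((k : ℝ) + 1) := div_nonneg (H_nonneg k) (by positivity)
  have hp : |(-x) ^ (k + 1)| ≤ 1 := by
    rw [abs_pow, abs_neg, abs_of_nonneg hx.1]; exact pow_le_one₀ hx.1 hx.2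
  have e : (-x) ^ (k + 1) * (H k * b (m + 1) k / ((k : ℝ) + 1))
    = (-x) ^ (k + 1) * ((H k / ((k : ℝ) + 1)) * b (m + 1) k) := by ring
  rw [Nat.succ_eq_add_one, e, Real.norm_eq_abs, abs_mul,
    abs_of_nonneg (mul_nonneg h0 (b_nonneg _ _))]
  calc |(-x) ^ (k + 1)| * ((H k / ((k : ℝ) + 1)) * b (m + 1) k)
      ≤ 1 * (1 * (1 / ((k : ℝ) + 1) ^ 2)) :=
        mul_le_mul hp (mul_le_mul hH hb (b_nonneg _ _) zero_le_one)
          (mul_nonneg h0 (b_nonneg _ _)) zero_le_one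
    _ = _ := by ring

lemma RR_cont (n : ℕ) : ContinuousOn (RR n) (Set.Ioc 0 1) := by
  have hL : ContinuousOn (fun t : ℝ => Real.log (1 + t)) (Set.Ioc 0 1) :=
    ContinuousOn.log (by fun_prop) (fun t ht => by have := ht.1; positivity)
  have hL' : ContinuousOn (fun t : ℝ => Real.log (t + 1)) (Set.Ioc 0 1) :=
    ContinuousOn.log (by fun_prop) (fun t ht => by have := ht.1; positivity)
  have hM : ContinuousOn (fun t : ℝ => Real.log t) (Set.Ioc 0 1) :=
    ContinuousOn.log (by fun_prop) (fun t ht => ht.1.ne')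
  have hu : ContinuousOn (fun t : ℝ => (t + 1) / t) (Set.Ioc 0 1) :=
    ContinuousOn.div (by fun_prop) (by fun_prop) (fun t ht => ht.1.ne')
  have hv : ContinuousOn (fun t : ℝ => 1 / (1 + t)) (Set.Ioc 0 1) :=
    ContinuousOn.div (by fun_prop) (by fun_prop) (fun t ht => by have := ht.1; positivity)
  have hm : Set.MapsTo (fun t : ℝ => 1 / (1 + t)) (Set.Ioc 0 1) (Set.Icc 0 1) := by
    intro t ht
    have h0 := ht.1
    refine ⟨by positivity, ?_⟩
    rw [div_le_one (by positivity)]; linarith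
  have h2 : ContinuousOn (fun t : ℝ => Li2 (1 / (1 + t))) (Set.Ioc 0 1) := Li2_cont.comp hv hm
  have h3 : ContinuousOn (fun t : ℝ => Li3 (1 / (1 + t))) (Set.Ioc 0 1) := Li3_cont.comp hv hm
  unfold RR R
  fun_prop

end AHB

/-- For `n` a positive integer and real `0 < t ≤ 1`,
`∑_{k=1}^∞ (-t)^k H_{k-1}/(k² C(n+k,k)) = (1/2)log t log²(t+1) - (1/3)log³(1+t)
  - log(1+t) Li₂(1/(1+t)) - Li₃(1/(1+t)) + ζ(3)
  + log(1+t) ∑_{k=1}^n (H_k/k)((t+1)/t)^k - (1/2)log²(1+t) ∑_{k=1}^n (1/k)((t+1)/t)^k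
  - ∑_{p=0}^{n-1} { ∑_{k=1}^{n-p} ( (H_{p+k}-H_k)/((p+k)k) + 1/(k²(p+k)) ) } ((t+1)/t)^p`. -/
theorem alt_harmonic_binom_series_sq (n : ℕ) (hn : 0 < n) (t : ℝ) (ht0 : 0 < t) (ht1 : t ≤ 1) :
    ∑' k : ℕ,
        (-t) ^ (k + 1) * H k / (((k : ℝ) + 1) ^ 2 * (Nat.choose (n + (k + 1)) (k + 1) : ℝ)) =
      1 / 2 * Real.log t * Real.log (t + 1) ^ 2 - 1 / 3 * Real.log (1 + t) ^ 3 -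
        Real.log (1 + t) * Li2 (1 / (1 + t)) - Li3 (1 / (1 + t)) + zeta3 +
        Real.log (1 + t) * (∑ k ∈ Finset.Icc 1 n, H k / (k : ℝ) * ((t + 1) / t) ^ k) -
        1 / 2 * Real.log (1 + t) ^ 2 *
          (∑ k ∈ Finset.Icc 1 n, 1 / (k : ℝ) * ((t + 1) / t) ^ k) -
        ∑ p ∈ Finset.range n,
          (∑ k ∈ Finset.Icc 1 (n - p),
              ((H (p + k) - H k) / (((p : ℝ) + (k : ℝ)) * (k : ℝ)) +
                1 / ((k : ℝ) ^ 2 * ((p : ℝ) + (k : ℝ))))) * ((t + 1) / t) ^ p := by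
  have hS : ∀ s : ℝ, ∑' k : ℕ,
        (-s) ^ (k + 1) * H k / (((k : ℝ) + 1) ^ 2 * (Nat.choose (n + (k + 1)) (k + 1) : ℝ))
      = AHB.S (-s) n := by
    intro s
    unfold AHB.S
    refine tsum_congr (fun k => ?_)
    rw [← AHB.b_choose]
    have : (Nat.choose (n + (k + 1)) (k + 1) : ℝ) ≠ 0 := by
      exact_mod_cast (Nat.choose_pos (Nat.le_add_left _ _)).ne'
    field_simp
  rw [hS]
  change AHB.S (-t) n = AHB.RR n t
  rcases ht1.lt_or_eq with h | h
  · exact AHB.main_lt n t ht0 h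
  · subst h
    have hsub : Set.Ioo (0 : ℝ) 1 ⊆ Set.Ioc 0 1 := Set.Ioo_subset_Ioc_self
    have h1 := ((AHB.S_cont n hn).mono Set.Ioc_subset_Icc_self 1 (by simp)).mono hsub
    have h2 := (AHB.RR_cont n 1 (by simp)).mono hsub
    have : (𝓝[Set.Ioo (0 : ℝ) 1] 1).NeBot := right_nhdsWithin_Ioo_neBot zero_lt_one
    refine tendsto_nhds_unique_of_eventuallyEq h1.tendsto h2.tendsto ?_
    filter_upwards [self_mem_nhdsWithin] with y hy
    exact AHB.main_lt n y hy.1 hy.2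
end
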